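/- Let F be a field, let f(x_1,…,x_n) be an n-variate polynomial over F of individual degree at most d, and let k ≥ 1 be an integer. Define g(x_1,…,x_n) := ∏_{ℓ=0}^{k−1} f(x_1^{(d+1)^ℓ}, x_2^{(d+1)^ℓ}, …, x_n^{(d+1)^ℓ}), a polynomial of individual degree at most (d+1)^k − 1. Then for every subset T ⊆ {1,…,n}, the rank of the Nisan matrix of g with respect to T (taken with individual degree bound (d+1)^k − 1) equals rank(M_T(f))^k, where M_T(f) is taken with individual degree bound d. Consequently, for every permutation σ of {1,…,n}, if the optimal ROABP-width of f in the order σ is w, then the optimal ROABP-width of g in the order σ is w^k. -/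

import Mathlib

open MvPolynomial

/-- `f` has individual degree at most `d`: every variable appears with exponent at most `d`
in every monomial of `f`. -/
def IndivDegLE {F : Type*} [CommSemiring F] {V : Type*} (f : MvPolynomial V F) (d : ℕ) : Prop :=
  ∀ m ∈ f.support, ∀ i : V, m i ≤ d

/-- The Nisan matrix of `f` with respect to the set `T` of variables, where exponents
range over `{0, …, d}`. -/
noncomputable def nisanMatrix {F : Type*} [Field F] {V : Type*} [Fintype V] [DecidableEq V]
    (d : ℕ) (f : MvPolynomial V F) (T : Finset V) :
    Matrix ({x : V // x ∈ T} → Fin (d + 1)) ({x : V // x ∉ T} → Fin (d + 1)) F :=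
  Matrix.of fun a b => MvPolynomial.coeff
    (Finsupp.equivFunOnFinite.symm fun i =>
      if h : i ∈ T then (a ⟨i, h⟩ : ℕ) else (b ⟨i, h⟩ : ℕ)) f

/-- Ordered product `L 0 * L 1 * ⋯ * L (k-1)` of matrices of varying dimensions. -/
def matProdUpTo {R : Type*} [CommSemiring R] (ws : ℕ → ℕ)
    (L : (i : ℕ) → Matrix (Fin (ws i)) (Fin (ws (i + 1))) R) :
    (k : ℕ) → Matrix (Fin (ws 0)) (Fin (ws k)) R
  | 0 => 1
  | k + 1 => matProdUpTo ws L k * L k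

/-- `f` has an ROABP of width `w` in the order `σ`: there are widths
`ws 0 = ws n = 1`, `1 ≤ ws i ≤ w` for `0 < i < n`, and coefficient matrices
`A i j ∈ F^{ws i × ws (i+1)}` such that `f` is the `(1,1)` entry of the ordered product
of the layer matrices `Σ_j A i j • x_{σ(i)}^j`. -/
def HasROABP {F : Type*} [Field F] {n : ℕ} (d : ℕ) (f : MvPolynomial (Fin n) F)
    (σ : Equiv.Perm (Fin n)) (w : ℕ) : Prop :=
  ∃ (ws : ℕ → ℕ) (A : (i : Fin n) → Fin (d + 1) →
      Matrix (Fin (ws i.val)) (Fin (ws (i.val + 1))) F),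
    ws 0 = 1 ∧ ws n = 1 ∧ (∀ i : ℕ, 0 < i → i < n → 1 ≤ ws i ∧ ws i ≤ w) ∧
    ∀ (p : Fin (ws 0)) (q : Fin (ws n)),
      f = matProdUpTo ws
        (fun i => if h : i < n then
            Matrix.of (fun p' q' => ∑ j : Fin (d + 1),
              MvPolynomial.C (A ⟨i, h⟩ j p' q') * MvPolynomial.X (σ ⟨i, h⟩) ^ (j : ℕ))
          else 0) n p q

/-- `T` is a prefix of the order `σ`, i.e. `T = {σ(1), …, σ(i)}` for some `i ∈ {1, …, n}`
(0-indexed: the image under `σ` of the first `i` positions). -/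
def IsPrefixOf {n : ℕ} (σ : Equiv.Perm (Fin n)) (T : Finset (Fin n)) : Prop :=
  ∃ i : ℕ, 1 ≤ i ∧ i ≤ n ∧
    T = (Finset.univ.filter fun l : Fin n => (l : ℕ) < i).image (fun l => σ l)

/-- The `(1,1)` entry of the ordered product of the layer matrices of a width-`w` ROABP
in the order `σ`, with coefficient matrices `A`. -/
noncomputable def roabpPoly {F : Type*} [Field F] {n : ℕ} (d w : ℕ) (hw : 0 < w)
    (σ : Equiv.Perm (Fin n)) (A : Fin n → Fin (d + 1) → Matrix (Fin w) (Fin w) F) :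
    MvPolynomial (Fin n) F :=
  (((List.finRange n).map fun i => Matrix.of fun p q =>
      ∑ j : Fin (d + 1), MvPolynomial.C (A i j p q) * MvPolynomial.X (σ i) ^ (j : ℕ)).prod)
    ⟨0, hw⟩ ⟨0, hw⟩

namespace TR

open scoped Kronecker TensorProduct

theorem rank_kron {F : Type*} [Field F] {l m n p : Type*} [Fintype l] [Fintype m] [Fintype n]
    [Fintype p] (A : Matrix l m F) (B : Matrix n p F) :
    (A ⊗ₖ B).rank = A.rank * B.rank := by
  classical
  rw [Matrix.rank_eq_finrank_range_toLin (A ⊗ₖ B)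
      ((Pi.basisFun F l).tensorProduct (Pi.basisFun F n))
      ((Pi.basisFun F m).tensorProduct (Pi.basisFun F p)),
    Matrix.toLin_kronecker,
    Matrix.rank_eq_finrank_range_toLin A (Pi.basisFun F l) (Pi.basisFun F m),
    Matrix.rank_eq_finrank_range_toLin B (Pi.basisFun F n) (Pi.basisFun F p),
    TensorProduct.range_map, ← TensorProduct.range_mapIncl, LinearMap.finrank_range_of_inj,
    Module.finrank_tensorProduct]
  exact TensorProduct.map_injective_of_flat_flat _ _ (Submodule.subtype_injective _)
    (Submodule.subtype_injective _)

theorem coeff_mul_expand {F : Type*} [Field F] {V : Type*} (g h : MvPolynomial V F) (D : ℕ)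
    (hD : 0 < D) (hg : ∀ m ∈ g.support, ∀ i, m i < D) (u v : V →₀ ℕ) (hu : ∀ i, u i < D) :
    coeff (u + D • v) (g * expand D h) = coeff u g * coeff v h := by
  classical
  rw [coeff_mul, Finset.sum_eq_single (u, D • v)]
  · rw [coeff_expand_smul _ hD.ne']
  · rintro ⟨p, q⟩ hpq hne
    rw [Finset.HasAntidiagonal.mem_antidiagonal] at hpq
    simp only at hpq ⊢
    by_contra hc
    have h1 : coeff p g ≠ 0 := left_ne_zero_of_mul hc
    have h2 : coeff q (expand D h) ≠ 0 := right_ne_zero_of_mul hc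
    have h3 : ∀ i, D ∣ q i := fun i => by
      by_contra hcc
      exact h2 (coeff_expand_of_not_dvd _ hcc)
    have h4 := hg p (mem_support_iff.2 h1)
    have hpu : p = u := by
      ext i
      have := DFunLike.congr_fun hpq i
      simp only [Finsupp.add_apply, Finsupp.smul_apply, smul_eq_mul] at this
      obtain ⟨c, hc⟩ := h3 i
      rw [hc] at this
      have h5 := congrArg (· % D) this
      simp only [Nat.add_mul_mod_self_left] at h5
      rwa [Nat.mod_eq_of_lt (h4 i), Nat.mod_eq_of_lt (hu i)] at h5
    apply hne
    subst hpu
    rw [Prod.mk.injEq]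
    exact ⟨rfl, add_left_cancel hpq⟩
  · intro hh
    exact absurd (by rw [Finset.HasAntidiagonal.mem_antidiagonal]) hh

theorem indiv_mul_expand {F : Type*} [Field F] {V : Type*} (g h : MvPolynomial V F) (a b e : ℕ)
    (he : e + 1 = (a + 1) * (b + 1)) (hg : IndivDegLE g a) (hh : IndivDegLE h b) :
    IndivDegLE (g * expand (a + 1) h) e := by
  classical
  intro m hm i
  obtain ⟨p, hp, q, hq, rfl⟩ := Finset.mem_add.1 (support_mul _ _ hm)
  obtain ⟨r, hr, rfl⟩ := Finset.mem_image.1 (support_expand_subset _ hq)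
  have h1 := hg p hp i
  have h2 := hh r hr i
  simp only [Finsupp.add_apply, Finsupp.smul_apply, smul_eq_mul]
  nlinarith

def digitEquiv (a b e : ℕ) (he : e + 1 = (a + 1) * (b + 1)) (ι : Type*) :
    (ι → Fin (e + 1)) ≃ (ι → Fin (b + 1)) × (ι → Fin (a + 1)) :=
  (Equiv.arrowCongr (Equiv.refl ι)
    ((finCongr (he.trans (Nat.mul_comm _ _))).trans finProdFinEquiv.symm)).trans
    (Equiv.arrowProdEquivProdArrow ι (fun _ => Fin (b + 1)) (fun _ => Fin (a + 1)))

theorem digitEquiv_spec (a b e : ℕ) (he : e + 1 = (a + 1) * (b + 1)) (ι : Type*)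
    (x : ι → Fin (e + 1)) (i : ι) :
    (x i : ℕ) = ((digitEquiv a b e he ι x).2 i : ℕ)
      + (a + 1) * ((digitEquiv a b e he ι x).1 i : ℕ) := by
  simp [digitEquiv, Equiv.arrowProdEquivProdArrow, Nat.mod_add_div]

theorem nisan_mul_expand {F : Type*} [Field F] {V : Type*} [Fintype V] [DecidableEq V]
    (g h : MvPolynomial V F) (a b e : ℕ)
    (he : e + 1 = (a + 1) * (b + 1)) (hg : IndivDegLE g a) (T : Finset V) :
    (nisanMatrix e (g * expand (a + 1) h) T).rank
      = (nisanMatrix b h T).rank * (nisanMatrix a g T).rank := by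
  rw [← rank_kron, ← Matrix.rank_submatrix (nisanMatrix b h T ⊗ₖ nisanMatrix a g T)
    (digitEquiv a b e he _) (digitEquiv a b e he _)]
  congr 1
  ext r c
  simp only [Matrix.submatrix_apply, nisanMatrix, Matrix.of_apply,
    Matrix.kroneckerMap_apply]
  rw [mul_comm (coeff _ h), ← coeff_mul_expand g h (a + 1) (Nat.succ_pos _)
    (fun m hm i => Nat.lt_succ_of_le (hg m hm i))]
  · congr 1
    ext i
    by_cases hi : i ∈ T
    · simpa [hi] using digitEquiv_spec a b e he _ r ⟨i, hi⟩
    · simpa [hi] using digitEquiv_spec a b e he _ c ⟨i, hi⟩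
  · intro i
    by_cases hi : i ∈ T <;> simp [hi] <;> exact Fin.is_le _

noncomputable def tens {F : Type*} [Field F] {n : ℕ} (d k : ℕ) (f : MvPolynomial (Fin n) F) :
    MvPolynomial (Fin n) F :=
  ∏ ℓ ∈ Finset.range k,
            eval₂ (C : F →+* MvPolynomial (Fin n) F) (fun i => X i ^ ((d + 1) ^ ℓ)) f

theorem tens_succ {F : Type*} [Field F] {n : ℕ} (d k : ℕ) (f : MvPolynomial (Fin n) F) :
    tens d (k + 1) f = tens d k f * expand ((d + 1) ^ k) f := by
  unfold tens
  rw [Finset.prod_range_succ]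
  rfl

theorem pow_aux (d k : ℕ) : (d + 1) ^ k - 1 + 1 = (d + 1) ^ k :=
  Nat.sub_add_cancel (Nat.one_le_pow _ _ (Nat.succ_pos _))

theorem pow_aux' (d k : ℕ) :
    (d + 1) ^ (k + 1) - 1 + 1 = ((d + 1) ^ k - 1 + 1) * (d + 1) := by
  rw [pow_aux, pow_aux, pow_succ]

theorem tens_indiv {F : Type*} [Field F] {n : ℕ} (d k : ℕ) (f : MvPolynomial (Fin n) F)
    (hf : IndivDegLE f d) : IndivDegLE (tens d k f) ((d + 1) ^ k - 1) := by
  induction k with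
  | zero =>
    intro m hm i
    have : m = 0 := by
      by_contra hc
      rw [mem_support_iff] at hm
      simp [tens, coeff_one, Ne.symm hc] at hm
    simp [this]
  | succ k ih =>
    rw [tens_succ]
    have := indiv_mul_expand _ f _ d _ (pow_aux' d k) ih hf
    rwa [pow_aux] at this

theorem tens_rank {F : Type*} [Field F] {n : ℕ} (d k : ℕ) (f : MvPolynomial (Fin n) F)
    (hf : IndivDegLE f d) (T : Finset (Fin n)) :
    (nisanMatrix ((d + 1) ^ k - 1) (tens d k f) T).rank = (nisanMatrix d f T).rank ^ k := by
  induction k with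
  | zero =>
    have h1 : nisanMatrix ((d + 1) ^ 0 - 1) (tens d 0 f) T
        = Matrix.of fun _ _ => (1 : F) := by
      ext a b
      have h0 : ∀ x : Fin ((d + 1) ^ 0 - 1 + 1), (x : ℕ) = 0 := by
        intro x
        have := x.2
        have h2 : (d + 1) ^ 0 = 1 := pow_zero _
        omega
      simp only [nisanMatrix, tens, Matrix.of_apply, Finset.range_zero, Finset.prod_empty]
      rw [coeff_one, if_pos]
      ext i
      by_cases hi : i ∈ T <;> simp [h0]
    rw [h1, pow_zero (Matrix.rank _)]
    have hu : ∀ ι : Type, Unique (ι → Fin ((d + 1) ^ 0 - 1 + 1)) := fun ι =>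
      (inferInstance : Unique (ι → Fin 1))
    let _ := hu {x // x ∈ T}
    let _ := hu {x // x ∉ T}
    apply le_antisymm
    · refine (Matrix.rank_le_card_width _).trans ?_
      simp
    · rw [Nat.one_le_iff_ne_zero]
      intro hc
      rw [Matrix.rank_eq_finrank_span_cols, Submodule.finrank_eq_zero, Submodule.span_eq_bot] at hc
      have := congrFun (hc _ ⟨default, rfl⟩) default
      exact one_ne_zero (α := F) this
  | succ k ih =>
    have e1 : tens d (k + 1) f = tens d k f * expand ((d + 1) ^ k - 1 + 1) f := by
      rw [tens_succ, pow_aux]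
    rw [e1]
    have := nisan_mul_expand _ f _ d _ (pow_aux' d k) (tens_indiv d k f hf) T
    rw [this, ih, pow_succ, mul_comm]

/-- coefficient polynomial of the monomial `e` on the variables `T` -/
noncomputable def Pp {F : Type*} [Field F] {V : Type*} [Fintype V] [DecidableEq V]
    (f : MvPolynomial V F) (T : Finset V) (e : V → ℕ) : MvPolynomial V F :=
  ∑ m ∈ f.support with (∀ x ∈ T, m x = e x), monomial (m.filter (· ∉ T)) (coeff m f)

theorem Pp_step {F : Type*} [Field F] {V : Type*} [Fintype V] [DecidableEq V]
    (f : MvPolynomial V F) (d : ℕ) (hf : IndivDegLE f d) (T : Finset V) (t : V) (ht : t ∉ T)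
    (e : V → ℕ) :
    Pp f T e = ∑ j : Fin (d + 1), X t ^ (j : ℕ) * Pp f (insert t T) (Function.update e t j) := by
  unfold Pp
  simp only [Finset.sum_filter, Finset.mul_sum]
  rw [Finset.sum_comm]
  refine Finset.sum_congr rfl fun m hm => ?_
  have hmt := hf m hm t
  have hcond : ∀ j : ℕ, (∀ x ∈ insert t T, m x = Function.update e t j x) ↔
      (m t = j ∧ ∀ x ∈ T, m x = e x) := by
    intro j
    rw [Finset.forall_mem_insert, Function.update_self]
    refine and_congr_right fun _ => forall₂_congr fun x hx => ?_
    rw [Function.update_of_ne]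
    rintro rfl
    exact ht hx
  simp only [hcond]
  rw [Finset.sum_eq_single (⟨m t, Nat.lt_succ_of_le hmt⟩ : Fin (d + 1))]
  · by_cases h : ∀ x ∈ T, m x = e x
    · rw [if_pos h, if_pos ⟨rfl, h⟩, X_pow_eq_monomial, monomial_mul, one_mul]
      refine congrArg (fun z => monomial z (coeff m f)) ?_
      ext x
      by_cases hx : x = t
      · subst hx
        simp [Finsupp.filter_apply, ht]
      · by_cases hxT : x ∈ T <;>
        simp [Finsupp.filter_apply, hxT, hx, Finsupp.single_apply, Ne.symm hx]
    · rw [if_neg h, if_neg (fun hh => h hh.2), mul_zero]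
  · intro j _ hj
    rw [if_neg, mul_zero]
    rintro ⟨hh, -⟩
    exact hj (Fin.ext hh.symm)
  · simp

noncomputable def extB {V : Type*} [Fintype V] [DecidableEq V] (d : ℕ) (T : Finset V)
    (b : {x : V // x ∉ T} → Fin (d + 1)) : V →₀ ℕ :=
  Finsupp.equivFunOnFinite.symm fun i => if h : i ∈ T then 0 else (b ⟨i, h⟩ : ℕ)

theorem Pp_eq {F : Type*} [Field F] {V : Type*} [Fintype V] [DecidableEq V]
    (f : MvPolynomial V F) (d : ℕ) (hf : IndivDegLE f d) (T : Finset V) (e : V → Fin (d + 1)) :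
    Pp f T (fun x => e x)
      = ∑ b, nisanMatrix d f T (fun x => e x) b • monomial (extB d T b) (1 : F) := by
  classical
  symm
  unfold Pp
  let J : ({x : V // x ∉ T} → Fin (d + 1)) → (V →₀ ℕ) := fun b =>
    Finsupp.equivFunOnFinite.symm fun i =>
      if h : i ∈ T then (e i : ℕ) else (b ⟨i, h⟩ : ℕ)
  have hJ : ∀ b, nisanMatrix d f T (fun x => e x) b = coeff (J b) f := fun b => rfl
  simp only [hJ]
  rw [← Finset.sum_filter_of_ne (p := fun b => coeff (J b) f ≠ 0)]
  · refine Finset.sum_bij (fun b _ => J b) ?_ ?_ ?_ ?_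
    · intro b hb
      simp only [Finset.mem_filter, Finset.mem_univ, true_and] at hb
      simp only [Finset.mem_filter, mem_support_iff]
      exact ⟨hb, fun x hx => by simp [J, hx]⟩
    · intro b _ b' _ hbb
      funext ⟨x, hx⟩
      have := DFunLike.congr_fun hbb x
      simp only [J, Finsupp.equivFunOnFinite_symm_apply_apply, hx, dif_neg,
        not_false_eq_true] at this
      exact Fin.ext this
    · intro m hm
      simp only [Finset.mem_filter] at hm
      have hJm : J (fun x => ⟨m x, Nat.lt_succ_of_le (hf m hm.1 x)⟩) = m := by
        ext x
        by_cases hx : x ∈ T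
        · simp [J, hx, hm.2 x hx]
        · simp [J, hx]
      refine ⟨fun x => ⟨m x, Nat.lt_succ_of_le (hf m hm.1 x)⟩, ?_, hJm⟩
      simp only [Finset.mem_filter, Finset.mem_univ, true_and, hJm]
      exact mem_support_iff.1 hm.1
    · intro b _
      rw [smul_monomial, smul_eq_mul, mul_one]
      refine congrArg (fun z => monomial z (coeff (J b) f)) ?_
      ext x
      by_cases hx : x ∈ T <;> simp [J, extB, hx, Finsupp.filter_apply]
  · intro b _ hb hc
    exact hb (by rw [hc, zero_smul])

noncomputable def Ss {F : Type*} [Field F] {V : Type*} [Fintype V] [DecidableEq V]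
    (f : MvPolynomial V F) (d : ℕ) (T : Finset V) : Submodule F (MvPolynomial V F) :=
  Submodule.span F (Set.range fun e : V → Fin (d + 1) => Pp f T (fun x => e x))

instance {F : Type*} [Field F] {V : Type*} [Fintype V] [DecidableEq V]
    (f : MvPolynomial V F) (d : ℕ) (T : Finset V) : FiniteDimensional F (Ss f d T) :=
  FiniteDimensional.span_of_finite F (Set.finite_range _)

theorem Ss_finrank {F : Type*} [Field F] {V : Type*} [Fintype V] [DecidableEq V]
    (f : MvPolynomial V F) (d : ℕ) (hf : IndivDegLE f d) (T : Finset V) :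
    Module.finrank F (Ss f d T) ≤ (nisanMatrix d f T).rank := by
  rw [Matrix.rank_eq_finrank_span_row]
  let Φ := Fintype.linearCombination F (fun b => monomial (extB d T b) (1 : F))
  have h : Ss f d T ≤ (Submodule.span F (Set.range (nisanMatrix d f T).row)).map Φ := by
    unfold Ss
    rw [Submodule.span_le]
    rintro _ ⟨e, rfl⟩
    refine ⟨_, Submodule.subset_span ⟨fun x => e x, rfl⟩, ?_⟩
    simp only
    rw [Pp_eq f d hf]
    rfl
  exact (Submodule.finrank_mono h).trans (Submodule.finrank_map_le _ _)

theorem Ss_step {F : Type*} [Field F] {V : Type*} [Fintype V] [DecidableEq V]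
    (f : MvPolynomial V F) (d : ℕ) (hf : IndivDegLE f d) (T : Finset V) (t : V) (ht : t ∉ T)
    (u : MvPolynomial V F) (hu : u ∈ Ss f d T) :
    ∃ c : Fin (d + 1) → MvPolynomial V F, (∀ j, c j ∈ Ss f d (insert t T)) ∧
      u = ∑ j : Fin (d + 1), X t ^ (j : ℕ) * c j := by
  induction hu using Submodule.span_induction with
  | mem x hx =>
    obtain ⟨e, rfl⟩ := hx
    refine ⟨_, fun j => ?_, Pp_step f d hf T t ht _⟩
    refine Submodule.subset_span ⟨Function.update e t j, ?_⟩
    simp only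
    congr 1
    funext x
    by_cases hx : x = t
    · subst hx; simp
    · simp [hx]
  | zero => exact ⟨0, fun j => Submodule.zero_mem _, by simp⟩
  | add x y _ _ hx hy =>
    obtain ⟨c, hc, hc'⟩ := hx
    obtain ⟨c2, hc2, hc2'⟩ := hy
    refine ⟨c + c2, fun j => Submodule.add_mem _ (hc j) (hc2 j), ?_⟩
    rw [hc', hc2', ← Finset.sum_add_distrib]
    simp [mul_add]
  | smul a x _ hx =>
    obtain ⟨c, hc, hc'⟩ := hx
    refine ⟨a • c, fun j => Submodule.smul_mem _ _ (hc j), ?_⟩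
    rw [hc', Finset.smul_sum]
    simp

theorem exists_family {F W : Type*} [Field F] [AddCommGroup W] [Module F W] (S : Submodule F W)
    [FiniteDimensional F S] (w : ℕ) (h : Module.finrank F S ≤ w) :
    ∃ v : Fin w → W, (∀ p, v p ∈ S) ∧ S ≤ Submodule.span F (Set.range v) := by
  let b := Module.finBasis F S
  refine ⟨fun p => if hp : (p : ℕ) < Module.finrank F S then (b ⟨p, hp⟩ : W) else 0, ?_, ?_⟩
  · intro p
    beta_reduce
    split_ifs
    · exact (b _).2
    · exact S.zero_mem
  · intro x hx
    have := b.sum_repr ⟨x, hx⟩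
    have h2 := congrArg Subtype.val this
    simp only at h2
    rw [← h2, Submodule.coe_sum]
    refine Submodule.sum_mem _ fun i _ => ?_
    rw [Submodule.coe_smul]
    refine Submodule.smul_mem _ _ (Submodule.subset_span ⟨⟨i, i.2.trans_le h⟩, ?_⟩)
    simp

def pre {n : ℕ} (σ : Equiv.Perm (Fin n)) (i : ℕ) : Finset (Fin n) :=
  Finset.univ.filter fun x => ((σ.symm x : Fin n) : ℕ) < i

theorem pre_succ {n : ℕ} (σ : Equiv.Perm (Fin n)) (i : ℕ) (hi : i < n) :
    pre σ (i + 1) = insert (σ ⟨i, hi⟩) (pre σ i) := by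
  ext x
  simp only [pre, Finset.mem_filter, Finset.mem_univ, true_and, Finset.mem_insert]
  rw [← Equiv.symm_apply_eq, Fin.ext_iff]
  simp only
  omega

theorem notMem_pre {n : ℕ} (σ : Equiv.Perm (Fin n)) (i : ℕ) (hi : i < n) :
    σ ⟨i, hi⟩ ∉ pre σ i := by
  simp [pre]

theorem pre_zero {n : ℕ} (σ : Equiv.Perm (Fin n)) : pre σ 0 = ∅ := by
  simp [pre]

theorem pre_n {n : ℕ} (σ : Equiv.Perm (Fin n)) : pre σ n = Finset.univ := by
  simp [pre]

theorem hasROABP_of {F : Type*} [Field F] {n : ℕ} (d : ℕ) (f : MvPolynomial (Fin n) F)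
    (hf : IndivDegLE f d) (σ : Equiv.Perm (Fin n)) (w : ℕ) (hn : 0 < n)
    (h : ∀ i, 0 < i → i < n → 1 ≤ w ∧ (nisanMatrix d f (pre σ i)).rank ≤ w) :
    HasROABP d f σ w := by
  have key : ∀ i : ℕ, ∃ (m : ℕ) (v : Fin m → MvPolynomial (Fin n) F),
      (i = 0 → m = 1 ∧ ∀ p, v p = f) ∧ (i = n → m = 1 ∧ ∀ p, v p = 1) ∧
      (0 < i → i < n → 1 ≤ m ∧ m ≤ w) ∧ (i < n → ∀ p, v p ∈ Ss f d (pre σ i)) ∧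
      (0 < i → i ≤ n → Ss f d (pre σ i) ≤ Submodule.span F (Set.range v)) := by
    intro i
    rcases Nat.eq_zero_or_pos i with rfl | hi
    · refine ⟨1, fun _ => f, fun _ => ⟨rfl, fun _ => rfl⟩, fun h0 => by omega,
        fun h0 => by omega, fun _ _ => ?_, fun h0 => by omega⟩
      refine Submodule.subset_span ⟨fun _ => 0, ?_⟩
      simp only [pre_zero, Pp]
      conv_rhs => rw [f.as_sum]
      refine Finset.sum_congr (by simp) fun m _ => ?_
      refine congrArg (fun z => monomial z (coeff m f)) ?_
      ext x
      simp
    · rcases lt_trichotomy i n with hin | rfl | hin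
      · obtain ⟨v, hv1, hv2⟩ := exists_family (Ss f d (pre σ i)) w
          ((Ss_finrank f d hf _).trans (h i hi hin).2)
        exact ⟨w, v, fun h0 => by omega, fun h0 => by omega, fun _ _ => ⟨(h i hi hin).1, le_rfl⟩,
          fun _ => hv1, fun _ _ => hv2⟩
      · refine ⟨1, fun _ => 1, fun h0 => by omega, fun _ => ⟨rfl, fun _ => rfl⟩,
          fun _ h0 => by omega, fun h0 => by omega, fun _ _ => ?_⟩
        unfold Ss
        rw [Submodule.span_le]
        rintro _ ⟨e, rfl⟩
        simp only [pre_n, Pp]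
        refine Submodule.sum_mem _ fun m _ => ?_
        have : monomial (m.filter (· ∉ (Finset.univ : Finset (Fin i)))) (coeff m f)
            = coeff m f • (1 : MvPolynomial (Fin i) F) := by
          have h0 : m.filter (· ∉ (Finset.univ : Finset (Fin i))) = 0 := by
            ext x; simp
          rw [h0, smul_eq_C_mul, mul_one]
          rfl
        rw [this]
        exact Submodule.smul_mem _ _ (Submodule.subset_span ⟨0, rfl⟩)
      · exact ⟨0, fun _ => 0, fun h0 => by omega, fun h0 => by omega, fun _ h0 => by omega,
          fun h0 => by omega, fun _ h0 => by omega⟩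
  choose ws v h0 hN hmid hmem hspan using key
  have step : ∀ (i : Fin n) (p : Fin (ws i)), ∃ B : Fin (d + 1) → Fin (ws (i + 1)) → F,
      v i p = ∑ j : Fin (d + 1), X (σ i) ^ (j : ℕ) * ∑ q, B j q • v (i + 1) q := by
    intro i p
    obtain ⟨c, hc, hcs⟩ := Ss_step f d hf _ _ (notMem_pre σ i i.2) (v i p) (hmem i i.2 p)
    rw [← pre_succ σ i i.2] at hc
    have : ∀ j, ∃ B : Fin (ws (i + 1)) → F, ∑ q, B q • v (i + 1) q = c j := fun j =>
      (Submodule.mem_span_range_iff_exists_fun F).1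
        (hspan (i + 1) (Nat.succ_pos _) i.2 (hc j))
    choose B hB using this
    refine ⟨B, ?_⟩
    simp only [hB]
    exact hcs
  choose B hB using step
  refine ⟨ws, fun i j => Matrix.of fun p q => B i p j q, (h0 0 rfl).1, (hN n rfl).1, hmid, ?_⟩
  intro p q
  set L : (i : ℕ) → Matrix (Fin (ws i)) (Fin (ws (i + 1))) (MvPolynomial (Fin n) F) :=
    (fun i => if h : i < n then
            Matrix.of (fun p' q' => ∑ j : Fin (d + 1),
              MvPolynomial.C ((Matrix.of fun p q => B ⟨i, h⟩ p j q : Matrix _ _ F) p' q')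
                * MvPolynomial.X (σ ⟨i, h⟩) ^ (j : ℕ))
          else 0) with hL
  have inv : ∀ i ≤ n, f = ∑ r, matProdUpTo ws L i p r * v i r := by
    intro i
    induction i with
    | zero =>
      intro _
      simp only [matProdUpTo, Matrix.one_apply, ite_mul, one_mul, zero_mul]
      rw [Finset.sum_ite_eq, if_pos (Finset.mem_univ _), (h0 0 rfl).2]
    | succ i ih =>
      intro hi
      have hvi : ∀ r, v i r = ∑ s, L i r s * v (i + 1) s := by
        intro r
        have := hB ⟨i, hi⟩ r
        rw [this]
        simp only [Finset.mul_sum]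
        rw [Finset.sum_comm]
        refine Finset.sum_congr rfl fun s _ => ?_
        have hlt : i < n := hi
        simp only [hL, dif_pos hlt, Matrix.of_apply, Finset.sum_mul]
        refine Finset.sum_congr rfl fun j _ => ?_
        rw [smul_eq_C_mul]
        ring
      conv_lhs => rw [ih (by omega)]
      simp only [matProdUpTo, Matrix.mul_apply, hvi, Finset.mul_sum, Finset.sum_mul]
      rw [Finset.sum_comm]
      refine Finset.sum_congr rfl fun s _ => Finset.sum_congr rfl fun r _ => ?_
      ring
  have hfin := inv n le_rfl
  have hone : ∀ r, r = q := by
    have h1 := (hN n rfl).1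
    intro r
    apply Fin.ext
    omega
  rw [Finset.sum_eq_single q (fun r _ hr => absurd (hone r) hr)
    (fun hh => absurd (Finset.mem_univ _) hh), (hN n rfl).2, mul_one] at hfin
  exact hfin

theorem coeff_mul_split {F : Type*} [Field F] {V : Type*} (g h : MvPolynomial V F) (T : Set V)
    (hg : g ∈ supported F T) (hh : h ∈ supported F Tᶜ) (u v : V →₀ ℕ)
    (hu : ∀ i ∉ T, u i = 0) (hv : ∀ i ∈ T, v i = 0) :
    coeff (u + v) (g * h) = coeff u g * coeff v h := by
  classical
  have aux : ∀ (q : MvPolynomial V F) (S : Set V), q ∈ supported F S → ∀ m, coeff m q ≠ 0 →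
      ∀ i ∉ S, m i = 0 := by
    intro q S hq m hm i hi
    by_contra hc
    apply hi
    apply (mem_supported.1 hq)
    exact Finset.mem_coe.2 ((mem_vars_iff_mem_support i).2 ⟨m, mem_support_iff.2 hm, Finsupp.mem_support_iff.2 hc⟩)
  rw [coeff_mul, Finset.sum_eq_single (u, v)]
  · rintro ⟨p, q⟩ hpq hne
    rw [Finset.HasAntidiagonal.mem_antidiagonal] at hpq
    simp only at hpq ⊢
    by_contra hc
    have h1 := aux g T hg p (left_ne_zero_of_mul hc)
    have h2 := aux h _ hh q (right_ne_zero_of_mul hc)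
    have hpu : p = u := by
      ext i
      have := DFunLike.congr_fun hpq i
      simp only [Finsupp.add_apply] at this
      by_cases hi : i ∈ T
      · rw [hv i hi, h2 i (by simpa using hi)] at this
        simpa using this
      · rw [hu i hi, h1 i hi]
    apply hne
    subst hpu
    rw [Prod.mk.injEq]
    exact ⟨rfl, add_left_cancel hpq⟩
  · intro hh
    exact absurd (by rw [Finset.HasAntidiagonal.mem_antidiagonal]) hh

theorem rank_le_of_split {F : Type*} [Field F] {V : Type*} [Fintype V] [DecidableEq V] (d m : ℕ)
    (f : MvPolynomial V F) (T : Finset V) (g h : Fin m → MvPolynomial V F)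
    (hg : ∀ q, g q ∈ supported F (T : Set V)) (hh : ∀ q, h q ∈ supported F (T : Set V)ᶜ)
    (hf : f = ∑ q, g q * h q) : (nisanMatrix d f T).rank ≤ m := by
  let G : Matrix ({x : V // x ∈ T} → Fin (d + 1)) (Fin m) F := Matrix.of fun a q =>
    coeff (Finsupp.equivFunOnFinite.symm fun i => if h : i ∈ T then (a ⟨i, h⟩ : ℕ) else 0) (g q)
  let H : Matrix (Fin m) ({x : V // x ∉ T} → Fin (d + 1)) F := Matrix.of fun q b =>
    coeff (extB d T b) (h q)
  have : nisanMatrix d f T = G * H := by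
    ext a b
    simp only [nisanMatrix, Matrix.of_apply, Matrix.mul_apply, G, H]
    rw [hf, coeff_sum]
    refine Finset.sum_congr rfl fun q _ => ?_
    rw [← coeff_mul_split _ _ _ (hg q) (hh q)]
    · congr 1
      ext i
      by_cases hi : i ∈ T <;> simp [hi, extB]
    · intro i hi
      have hi' : i ∉ T := by simpa using hi
      simp [hi']
    · intro i hi
      have hi' : i ∈ T := by simpa using hi
      simp [hi', extB]
  rw [this]
  refine (Matrix.rank_mul_le_left _ _).trans ((Matrix.rank_le_card_width _).trans ?_)
  simp

theorem rank_le_of_hasROABP {F : Type*} [Field F] {n : ℕ} (d : ℕ) (f : MvPolynomial (Fin n) F)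
    (σ : Equiv.Perm (Fin n)) (w : ℕ) (hR : HasROABP d f σ w) (i : ℕ) (hi : 0 < i) (hin : i < n) :
    1 ≤ w ∧ (nisanMatrix d f (pre σ i)).rank ≤ w := by
  obtain ⟨ws, A, hw0, hwn, hw, hA⟩ := hR
  have hwi := hw i hi hin
  refine ⟨hwi.1.trans hwi.2, le_trans ?_ hwi.2⟩
  have hfm := hA ⟨0, by omega⟩ ⟨0, by omega⟩
  clear hA
  set L : (i : ℕ) → Matrix (Fin (ws i)) (Fin (ws (i + 1))) (MvPolynomial (Fin n) F) :=
    (fun i => if h : i < n then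
            Matrix.of (fun p' q' => ∑ j : Fin (d + 1),
              MvPolynomial.C (A ⟨i, h⟩ j p' q') * MvPolynomial.X (σ ⟨i, h⟩) ^ (j : ℕ))
          else 0) with hL
  have hLs : ∀ (i : ℕ) (hi : i < n) (S : Set (Fin n)), σ ⟨i, hi⟩ ∈ S → ∀ p q,
      L i p q ∈ supported F S := by
    intro i hi S hS p q
    simp only [hL, dif_pos hi, Matrix.of_apply]
    refine Subalgebra.sum_mem _ fun j _ => Subalgebra.mul_mem _ ?_ (Subalgebra.pow_mem _ ?_ _)
    · exact Subalgebra.algebraMap_mem _ _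
    · exact X_mem_supported.2 hS
  have left : ∀ i ≤ n, ∀ p q, matProdUpTo ws L i p q ∈ supported F (pre σ i : Set (Fin n)) := by
    intro i
    induction i with
    | zero =>
      intro _ p q
      simp only [matProdUpTo, Matrix.one_apply]
      split_ifs
      · exact Subalgebra.one_mem _
      · exact Subalgebra.zero_mem _
    | succ i ih =>
      intro hi p q
      simp only [matProdUpTo, Matrix.mul_apply]
      have hs := pre_succ σ i hi
      refine Subalgebra.sum_mem _ fun j _ => Subalgebra.mul_mem _ ?_ ?_
      · refine supported_mono ?_ (ih (by omega) p j)
        rw [hs]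
        exact Finset.coe_subset.2 (Finset.subset_insert _ _)
      · refine hLs i hi _ ?_ _ _
        rw [hs]
        simp
  have right : ∀ t, i + t ≤ n → ∃ R : Matrix (Fin (ws i)) (Fin (ws (i + t)))
      (MvPolynomial (Fin n) F), matProdUpTo ws L (i + t) = matProdUpTo ws L i * R ∧
      ∀ p q, R p q ∈ supported F (pre σ i : Set (Fin n))ᶜ := by
    intro t
    induction t with
    | zero =>
      intro _
      refine ⟨(1 : Matrix (Fin (ws i)) (Fin (ws i)) _), (Matrix.mul_one _).symm, fun p q => ?_⟩
      rw [Matrix.one_apply]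
      split_ifs
      · exact Subalgebra.one_mem _
      · exact Subalgebra.zero_mem _
    | succ t ih =>
      intro ht
      obtain ⟨R, hR, hRs⟩ := ih (by omega)
      refine ⟨(R * L (i + t) : Matrix (Fin (ws i)) (Fin (ws (i + t + 1))) _), ?_, fun p q => ?_⟩
      · rw [← Matrix.mul_assoc, ← hR]
        rfl
      · rw [Matrix.mul_apply]
        refine Subalgebra.sum_mem _ fun j _ => Subalgebra.mul_mem _ (hRs _ _) ?_
        refine hLs (i + t) ht _ ?_ _ _
        simp [pre]
  obtain ⟨t, rfl⟩ := Nat.exists_eq_add_of_lt hin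
  obtain ⟨R, hR, hRs⟩ := right (t + 1) le_rfl
  have hR2 : matProdUpTo ws L (i + t + 1) = matProdUpTo ws L i * R := hR
  rw [hR2, Matrix.mul_apply] at hfm
  exact rank_le_of_split d (ws i) f _ _ _ (fun q => left i hin.le _ q) (fun q => hRs q _) hfm

theorem hasROABP_iff {F : Type*} [Field F] {n : ℕ} (d : ℕ) (f : MvPolynomial (Fin n) F)
    (hf : IndivDegLE f d) (σ : Equiv.Perm (Fin n)) (w : ℕ) (hn : 0 < n) :
    HasROABP d f σ w ↔
      ∀ i, 0 < i → i < n → 1 ≤ w ∧ (nisanMatrix d f (pre σ i)).rank ≤ w :=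
  ⟨fun h i => rank_le_of_hasROABP d f σ w h i, hasROABP_of d f hf σ w hn⟩

theorem hasROABP_zero_iff {F : Type*} [Field F] (d : ℕ) (f : MvPolynomial (Fin 0) F)
    (σ : Equiv.Perm (Fin 0)) (w : ℕ) : HasROABP d f σ w ↔ f = 1 := by
  constructor
  · rintro ⟨ws, A, h0, -, -, h⟩
    have := h ⟨0, by omega⟩ ⟨0, by omega⟩
    simpa [matProdUpTo] using this
  · rintro rfl
    refine ⟨fun _ => 1, fun i => i.elim0, rfl, rfl, fun i h1 h2 => by omega, fun p q => ?_⟩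
    have : p = q := Subsingleton.elim (α := Fin 1) p q
    subst this
    exact (Matrix.one_apply_eq p).symm

theorem main {F : Type*} [Field F] {n d k : ℕ} (hk : 1 ≤ k)
    (f : MvPolynomial (Fin n) F) (hf : IndivDegLE f d) (σ : Equiv.Perm (Fin n)) (w : ℕ)
    (h : IsLeast {w' | HasROABP d f σ w'} w) :
    IsLeast {w' | HasROABP ((d + 1) ^ k - 1) (tens d k f) σ w'} (w ^ k) := by
  obtain ⟨h1, h2⟩ := h
  simp only [Set.mem_ofPred_eq] at h1
  have h3 : ∀ w', HasROABP d f σ w' → w ≤ w' := fun w' hw' => h2 hw'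
  clear h2
  have hk0 : k ≠ 0 := by omega
  rcases Nat.eq_zero_or_pos n with rfl | hn
  · rw [hasROABP_zero_iff] at h1
    have hw : w = 0 := Nat.le_zero.1 (h3 0 ((hasROABP_zero_iff _ _ _ _).2 h1))
    subst hw
    rw [zero_pow hk0]
    refine ⟨?_, fun _ _ => Nat.zero_le _⟩
    simp only [Set.mem_ofPred_eq]
    rw [hasROABP_zero_iff]
    subst h1
    simp [tens]
  · simp only [hasROABP_iff d f hf σ _ hn] at h1 h3
    simp only [hasROABP_iff _ _ (tens_indiv d k f hf) σ _ hn, tens_rank d k f hf]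
    constructor
    · intro i hi hin
      exact ⟨Nat.one_le_pow _ _ (h1 i hi hin).1, Nat.pow_le_pow_left (h1 i hi hin).2 _⟩
    · intro w' hw'
      simp only [Set.mem_ofPred_eq] at hw'
      by_contra hlt
      push Not at hlt
      rcases Nat.lt_or_ge 1 n with hn1 | hn1
      · have hp := hw' 1 one_pos hn1
        have hw2 : 2 ≤ w := by
          by_contra hc
          have : w ^ k ≤ 1 := Nat.pow_le_one_iff hk0 |>.2 (by omega)
          omega
        have := h3 (w - 1) (fun i hi hin => ⟨by omega, by
          have h5 := (hw' i hi hin).2.trans_lt hlt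
          have := lt_of_pow_lt_pow_left₀ k (Nat.zero_le _) h5
          omega⟩)
        omega
      · have := h3 0 (fun i hi hin => by omega)
        have hw : w = 0 := by omega
        rw [hw, zero_pow hk0] at hlt
        omega

end TR

/-- **Tensoring ROABP width.** For `g(x) = ∏_{ℓ=0}^{k−1} f(x_1^{(d+1)^ℓ}, …, x_n^{(d+1)^ℓ})`
(of individual degree at most `(d+1)^k − 1`), the Nisan rank of `g` w.r.t. every `T` is the
`k`-th power of the Nisan rank of `f` w.r.t. `T`; consequently, for every order `σ`, if the
optimal ROABP-width of `f` in the order `σ` is `w`, then the optimal ROABP-width of `g` in the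
order `σ` is `w^k`. -/
theorem tensoring_roabp_width {F : Type*} [Field F] {n d k : ℕ} (hk : 1 ≤ k)
    (f : MvPolynomial (Fin n) F) (hf : IndivDegLE f d) :
    (∀ T : Finset (Fin n),
      (nisanMatrix ((d + 1) ^ k - 1)
          (∏ ℓ ∈ Finset.range k,
            eval₂ (C : F →+* MvPolynomial (Fin n) F) (fun i => X i ^ ((d + 1) ^ ℓ)) f) T).rank
        = (nisanMatrix d f T).rank ^ k) ∧
    ∀ (σ : Equiv.Perm (Fin n)) (w : ℕ),
      IsLeast {w' | HasROABP d f σ w'} w →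
      IsLeast {w' | HasROABP ((d + 1) ^ k - 1)
          (∏ ℓ ∈ Finset.range k,
            eval₂ (C : F →+* MvPolynomial (Fin n) F) (fun i => X i ^ ((d + 1) ^ ℓ)) f) σ w'}
        (w ^ k) := by
  exact ⟨fun T => TR.tens_rank d k f hf T, fun σ w h => TR.main hk f hf σ w h⟩
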